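/- Let X be a compact complex manifold. Suppose dim_ℝ H¹(X,P) = dim_ℂ H^{1,1}_BC(X,ℂ), the projection π^{0,2} : H²(X,ℝ) → H²(X,O_X) is surjective, and h¹(X) = 2h^{0,1}_∂̄(X). Then h²(X) = 2h^{0,2}_∂̄(X) + h^{1,1}_BC(X). -/

import Mathlib

noncomputable section

/-- An abstract model of the bigraded algebra of smooth complex-valued differential forms
on a compact complex manifold of complex dimension `n`, together with the Dolbeault
operators `dd1 = ∂` and `dd2 = ∂̄`, complex conjugation, wedge product, the bidegree
projections and integration over the (compact) manifold. -/
structure CMF (n : ℕ) where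
  Ω : Type
  [acg : AddCommGroup Ω]
  [mod : Module ℂ Ω]
  /-- the subspace of forms of bidegree `(p, q)` -/
  forms : ℕ → ℕ → Submodule ℂ Ω
  /-- the constant function `1`, a `(0,0)`-form -/
  one : Ω
  one_mem : one ∈ forms 0 0
  /-- the wedge product -/
  wedge : Ω →ₗ[ℂ] Ω →ₗ[ℂ] Ω
  /-- the operator `∂` -/
  dd1 : Ω →ₗ[ℂ] Ω
  /-- the operator `∂̄` -/
  dd2 : Ω →ₗ[ℂ] Ω
  /-- complex conjugation of forms -/
  conj : Ω → Ω
  /-- the bidegree `(p,q)` projection -/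
  proj : ℕ → ℕ → Ω →ₗ[ℂ] Ω
  /-- integration over the compact manifold -/
  integ : Ω →ₗ[ℂ] ℂ
  wedge_mem : ∀ {p q r s : ℕ} {a b : Ω}, a ∈ forms p q → b ∈ forms r s →
    wedge a b ∈ forms (p + r) (q + s)
  dd1_mem : ∀ {p q : ℕ} {a : Ω}, a ∈ forms p q → dd1 a ∈ forms (p + 1) q
  dd2_mem : ∀ {p q : ℕ} {a : Ω}, a ∈ forms p q → dd2 a ∈ forms p (q + 1)
  conj_mem : ∀ {p q : ℕ} {a : Ω}, a ∈ forms p q → conj a ∈ forms q p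
  conj_conj : ∀ a, conj (conj a) = a
  dd1_dd1 : ∀ a, dd1 (dd1 a) = 0
  dd2_dd2 : ∀ a, dd2 (dd2 a) = 0
  /-- Stokes' theorem on a compact manifold -/
  integ_dd1 : ∀ a, integ (dd1 a) = 0
  integ_dd2 : ∀ a, integ (dd2 a) = 0
  /-- only the `(n,n)`-component of a form has nonzero integral -/
  integ_vanish : ∀ {p q : ℕ} {a : Ω}, a ∈ forms p q → (p, q) ≠ (n, n) → integ a = 0
  proj_mem : ∀ (p q : ℕ) (a : Ω), proj p q a ∈ forms p q
  proj_eq_self : ∀ {p q : ℕ} {a : Ω}, a ∈ forms p q → proj p q a = a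
  proj_sum : ∀ (k : ℕ) (a : Ω), a ∈ (⨆ p ∈ Finset.range (k + 1), forms p (k - p)) →
    a = ∑ p ∈ Finset.range (k + 1), proj p (k - p) a

attribute [instance] CMF.acg CMF.mod

namespace CMF

variable {n : ℕ} (X : CMF n)

/-- wedge powers: `pow ω k = ω ∧ ⋯ ∧ ω` (`k` factors), with `pow ω 0 = 1`. -/
def pow (ω : X.Ω) : ℕ → X.Ω
  | 0 => X.one
  | k + 1 => X.wedge ω (pow ω k)

/-- the space of total `k`-forms -/
def totForms (k : ℕ) : Submodule ℂ X.Ω :=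
  ⨆ p ∈ Finset.range (k + 1), X.forms p (k - p)

/-- the de Rham differential `d = ∂ + ∂̄` -/
def dd : X.Ω →ₗ[ℂ] X.Ω := X.dd1 + X.dd2

/-- `d`-closed `k`-forms -/
def ZdR (k : ℕ) : Submodule ℂ X.Ω := X.totForms k ⊓ LinearMap.ker X.dd
/-- `d`-exact `d`-closed `k`-forms -/
def BdR (k : ℕ) : Submodule ℂ X.Ω :=
  Submodule.map X.dd (X.totForms (k - 1)) ⊓ X.ZdR k
/-- the `k`-th de Rham Betti number `h^k = dim_ℂ H^k_dR(X, ℂ)` -/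
def h (k : ℕ) : ℕ :=
  Module.finrank ℂ (↥(X.ZdR k) ⧸ Submodule.comap (X.ZdR k).subtype (X.BdR k))

/-- `∂̄`-closed `(p,q)`-forms -/
def ZDb (p q : ℕ) : Submodule ℂ X.Ω := X.forms p q ⊓ LinearMap.ker X.dd2
/-- `∂̄`-exact `∂̄`-closed `(p,q)`-forms -/
def BDb (p q : ℕ) : Submodule ℂ X.Ω :=
  Submodule.map X.dd2 (X.forms p (q - 1)) ⊓ X.ZDb p q
/-- the Hodge number `h^{p,q}_∂̄ = dim_ℂ H^{p,q}_∂̄(X, ℂ)` (Dolbeault cohomology) -/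
def hDb (p q : ℕ) : ℕ :=
  Module.finrank ℂ (↥(X.ZDb p q) ⧸ Submodule.comap (X.ZDb p q).subtype (X.BDb p q))

/-- `∂`-closed `(p,q)`-forms -/
def ZDp (p q : ℕ) : Submodule ℂ X.Ω := X.forms p q ⊓ LinearMap.ker X.dd1
/-- `∂`-exact `∂`-closed `(p,q)`-forms -/
def BDp (p q : ℕ) : Submodule ℂ X.Ω :=
  Submodule.map X.dd1 (X.forms (p - 1) q) ⊓ X.ZDp p q
/-- `h^{p,q}_∂ = dim_ℂ H^{p,q}_∂(X, ℂ)` (`∂`-cohomology) -/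
def hDp (p q : ℕ) : ℕ :=
  Module.finrank ℂ (↥(X.ZDp p q) ⧸ Submodule.comap (X.ZDp p q).subtype (X.BDp p q))

/-- `∂`- and `∂̄`-closed `(p,q)`-forms -/
def ZBC (p q : ℕ) : Submodule ℂ X.Ω :=
  X.forms p q ⊓ LinearMap.ker X.dd1 ⊓ LinearMap.ker X.dd2
/-- `∂∂̄`-exact Bott--Chern-closed `(p,q)`-forms -/
def BBC (p q : ℕ) : Submodule ℂ X.Ω :=
  Submodule.map (X.dd1 ∘ₗ X.dd2) (X.forms (p - 1) (q - 1)) ⊓ X.ZBC p q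
/-- `h^{p,q}_BC = dim_ℂ H^{p,q}_BC(X, ℂ)` (Bott--Chern cohomology) -/
def hBC (p q : ℕ) : ℕ :=
  Module.finrank ℂ (↥(X.ZBC p q) ⧸ Submodule.comap (X.ZBC p q).subtype (X.BBC p q))

/-- `ω` is a Hermitian metric: a real `(1,1)`-form whose positivity is encoded by
definiteness of the induced hermitian pairing
`(η, η') ↦ ∫_X η ∧ conj η' ∧ ω^{n-p}` on `(p,0)`-forms. -/
def IsMetric (ω : X.Ω) : Prop :=
  ω ∈ X.forms 1 1 ∧ X.conj ω = ω ∧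
    ∀ p : ℕ, p ≤ n → ∀ η : X.Ω, η ∈ X.forms p 0 →
      X.integ (X.wedge (X.wedge η (X.conj η)) (X.pow ω (n - p))) = 0 → η = 0

end CMF

/-- if `dim_ℝ H¹(X,P) = h^{1,1}_BC(X)`, the projection
`π^{0,2} : H²(X,ℝ) → H²(X,O_X)` is surjective, and `h¹(X) = 2h^{0,1}_∂̄(X)`, then
`h²(X) = 2h^{0,2}_∂̄(X) + h^{1,1}_BC(X)`.  The sheaf cohomology of the sheaf `P` of real
pluriharmonic functions and of `O_X` (as real vector spaces) is modelled by
finite-dimensional real vector spaces fitting in the exact sequence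
`0 → H¹(X,ℝ) → H¹(X,O_X) → H¹(X,P) → H²(X,ℝ) → H²(X,O_X) → 0`, with
`dim_ℝ H^k(X,ℝ) = h^k(X)` and `dim_ℝ H^q(X,O_X) = 2·h^{0,q}_∂̄(X)`. -/
theorem h2_eq_of_pluriharmonic {n : ℕ} (X : CMF n)
    {H1R H1O H1P H2R H2O : Type}
    [AddCommGroup H1R] [Module ℝ H1R] [FiniteDimensional ℝ H1R]
    [AddCommGroup H1O] [Module ℝ H1O] [FiniteDimensional ℝ H1O]
    [AddCommGroup H1P] [Module ℝ H1P] [FiniteDimensional ℝ H1P]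
    [AddCommGroup H2R] [Module ℝ H2R] [FiniteDimensional ℝ H2R]
    [AddCommGroup H2O] [Module ℝ H2O] [FiniteDimensional ℝ H2O]
    (f1 : H1R →ₗ[ℝ] H1O) (f2 : H1O →ₗ[ℝ] H1P) (f3 : H1P →ₗ[ℝ] H2R)
    (pi02 : H2R →ₗ[ℝ] H2O)
    (hinj : Function.Injective f1)
    (hex1 : LinearMap.range f1 = LinearMap.ker f2)
    (hex2 : LinearMap.range f2 = LinearMap.ker f3)
    (hex3 : LinearMap.range f3 = LinearMap.ker pi02)
    (hsurj : Function.Surjective pi02)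
    (hR1 : Module.finrank ℝ H1R = X.h 1)
    (hR2 : Module.finrank ℝ H2R = X.h 2)
    (hO1 : Module.finrank ℝ H1O = 2 * X.hDb 0 1)
    (hO2 : Module.finrank ℝ H2O = 2 * X.hDb 0 2)
    (hP : Module.finrank ℝ H1P = X.hBC 1 1)
    (hb1 : X.h 1 = 2 * X.hDb 0 1) :
    X.h 2 = 2 * X.hDb 0 2 + X.hBC 1 1 := by
  have e1 := LinearMap.finrank_range_of_inj hinj
  have r2 := LinearMap.finrank_range_add_finrank_ker f2
  have r3 := LinearMap.finrank_range_add_finrank_ker f3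
  have r4 := LinearMap.finrank_range_add_finrank_ker pi02
  have e4 : Module.finrank ℝ (LinearMap.range pi02) = Module.finrank ℝ H2O := by
    rw [LinearMap.range_eq_top.mpr hsurj, finrank_top]
  rw [← hex1] at r2
  rw [← hex2] at r3
  rw [← hex3] at r4
  omega
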